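/- Let U ⊆ ℝ² be a connected open set and P : U → ℝ analytic, such that neither ∂ₓP nor ∂ᵧP vanishes identically on U. Then P is an analytic special form if and only if ∂ₓᵧ(log(∂ₓP/∂ᵧP)) vanishes everywhere on U where it is defined (i.e., wherever ∂ₓP and ∂ᵧP are nonzero). Moreover, if ∂ₓP or ∂ᵧP vanishes identically on U, then P is an analytic special form. -/

import Mathlib

/-- Partial derivative in the first variable of a function on `ℝ²`. -/
noncomputable def pdx (f : ℝ × ℝ → ℝ) : ℝ × ℝ → ℝ :=
  fun p => deriv (fun t => f (t, p.2)) p.1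

/-- Partial derivative in the second variable of a function on `ℝ²`. -/
noncomputable def pdy (f : ℝ × ℝ → ℝ) : ℝ × ℝ → ℝ :=
  fun p => deriv (fun t => f (p.1, t)) p.2

/-- `P` is an *analytic special form* on `U` if, on each connected component of
`U \ ({∂ₓP = 0} ∪ {∂ᵧP = 0})`, there are univariate real analytic functions `h, a, b`
with `P(x,y) = h(a x + b y)`. -/
def IsAnalyticSpecialForm (U : Set (ℝ × ℝ)) (P : ℝ × ℝ → ℝ) : Prop :=
  ∀ p ∈ {q ∈ U | pdx P q ≠ 0 ∧ pdy P q ≠ 0},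
    ∃ h a b : ℝ → ℝ,
      AnalyticOnNhd ℝ a
          (Prod.fst '' connectedComponentIn {q ∈ U | pdx P q ≠ 0 ∧ pdy P q ≠ 0} p) ∧
      AnalyticOnNhd ℝ b
          (Prod.snd '' connectedComponentIn {q ∈ U | pdx P q ≠ 0 ∧ pdy P q ≠ 0} p) ∧
      AnalyticOnNhd ℝ h
          ((fun q : ℝ × ℝ => a q.1 + b q.2) ''
            connectedComponentIn {q ∈ U | pdx P q ≠ 0 ∧ pdy P q ≠ 0} p) ∧
      ∀ q ∈ connectedComponentIn {q ∈ U | pdx P q ≠ 0 ∧ pdy P q ≠ 0} p,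
        P q = h (a q.1 + b q.2)

open Set Filter Topology

/-- A function whose derivative is real analytic near a point is real analytic there. -/
lemma AnalyticAt.of_eventually_hasDerivAt {f F : ℝ → ℝ} {x : ℝ} (hf : AnalyticAt ℝ f x)
    (hF : ∀ᶠ y in 𝓝 x, HasDerivAt F (f y) y) : AnalyticAt ℝ F x := by
  obtain ⟨p, hp⟩ := id hf
  let c : ℕ → ℝ := fun n => Nat.casesOn n (F x) (fun m => p.coeff m / (m + 1))
  refine ⟨FormalMultilinearSeries.ofScalars ℝ c, ?_⟩
  rw [hasFPowerSeriesAt_iff]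
  have h1 := hasFPowerSeriesAt_iff.1 hp
  have h2 : ∀ᶠ z in 𝓝 (0 : ℝ), HasDerivAt F (f (x + z)) (x + z) ∧ ContinuousAt f (x + z) := by
    have := hF.and (hf.eventually_analyticAt.mono fun y hy => hy.continuousAt)
    rwa [← map_add_left_nhds_zero, eventually_map] at this
  obtain ⟨ε, hε, h⟩ := Metric.eventually_nhds_iff.1 (h1.and h2)
  refine Metric.eventually_nhds_iff.2 ⟨ε, hε, fun z hz => ?_⟩
  simp only [FormalMultilinearSeries.coeff_ofScalars, smul_eq_mul, dist_zero_right,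
    Real.norm_eq_abs] at h hz ⊢
  have hmem : ∀ t ∈ uIcc 0 z, |t| ≤ |z| := fun t ht => by
    simpa using abs_sub_left_of_mem_uIcc ht
  have hsum : HasSum (fun n => ∫ t in (0 : ℝ)..z, t ^ n * p.coeff n)
      (∫ t in (0 : ℝ)..z, f (x + t)) := by
    refine intervalIntegral.hasSum_integral_of_dominated_convergence
      (fun n _ => |z| ^ n * |p.coeff n|) (fun n => by fun_prop) (fun n => ?_) ?_ ?_ ?_
    · refine Eventually.of_forall fun t ht => ?_
      rw [Real.norm_eq_abs, abs_mul, abs_pow]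
      exact mul_le_mul_of_nonneg_right
        (pow_le_pow_left₀ (abs_nonneg t) (hmem t (uIoc_subset_uIcc ht)) n) (abs_nonneg _)
    · refine Eventually.of_forall fun t ht => ?_
      simpa [abs_mul] using (h hz).1.summable.abs
    · simp
    · refine Eventually.of_forall fun t ht => ?_
      exact (h ((hmem t (uIoc_subset_uIcc ht)).trans_lt hz)).1
  have hint : ∫ t in (0 : ℝ)..z, f (x + t) = F (x + z) - F x := by
    have hd : ∀ t ∈ uIcc 0 z, HasDerivAt (fun t => F (x + t)) (f (x + t)) t := fun t ht => by
      simpa using (h ((hmem t ht).trans_lt hz)).2.1.comp_const_add x t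
    have hc : ContinuousOn (fun t => f (x + t)) (uIcc 0 z) := fun t ht =>
      (ContinuousAt.comp' (h ((hmem t ht).trans_lt hz)).2.2 (by fun_prop)).continuousWithinAt
    simpa using intervalIntegral.integral_eq_sub_of_hasDerivAt hd hc.intervalIntegrable
  rw [hint] at hsum
  have hterm : ∀ n : ℕ, ∫ t in (0 : ℝ)..z, t ^ n * p.coeff n = z ^ (n + 1) * c (n + 1) := by
    intro n
    simp only [intervalIntegral.integral_mul_const, integral_pow, c]
    simp
    ring
  simp only [hterm] at hsum
  rw [← hasSum_nat_add_iff' 1]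
  simpa [c] using hsum

/-- Gluing of germs: a function on a connected space that locally factors analytically through an
open map to `ℝ` does so globally. -/
lemma IsPreconnected.exists_analytic_factorization {X : Type*} [TopologicalSpace X] {V : Set X}
    (hV : IsOpen V) (hVc : IsPreconnected V) {u G : X → ℝ} (hu : ∀ q ∈ V, ContinuousAt u q)
    (huo : ∀ q ∈ V, 𝓝 (u q) ≤ map u (𝓝 q))
    (hloc : ∀ q ∈ V, ∃ h, AnalyticAt ℝ h (u q) ∧ ∀ᶠ z in 𝓝 q, G z = h (u z)) :
    ∃ H, AnalyticOnNhd ℝ H (u '' V) ∧ ∀ q ∈ V, G q = H (u q) := by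
  choose! h hh hG using hloc
  have key : ∀ q₁ ∈ V, ∀ q₂ ∈ V, ∃ (J : Set ℝ) (H : ℝ → ℝ), IsOpen J ∧ IsPreconnected J ∧
      AnalyticOnNhd ℝ H J ∧ u q₁ ∈ J ∧ u q₂ ∈ J ∧ H =ᶠ[𝓝 (u q₁)] h q₁ ∧
      H =ᶠ[𝓝 (u q₂)] h q₂ := by
    intro q₁ hq₁ q₂ hq₂
    refine hVc.induction₂ (fun q₁ q₂ => ∃ (J : Set ℝ) (H : ℝ → ℝ), IsOpen J ∧ IsPreconnected J ∧
      AnalyticOnNhd ℝ H J ∧ u q₁ ∈ J ∧ u q₂ ∈ J ∧ H =ᶠ[𝓝 (u q₁)] h q₁ ∧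
      H =ᶠ[𝓝 (u q₂)] h q₂) ?_ ?_ ?_ hq₁ hq₂
    · intro q hq
      obtain ⟨ε, hε, hball⟩ := Metric.eventually_nhds_iff_ball.1 (hh q hq).eventually_analyticAt
      filter_upwards [nhdsWithin_le_nhds (hG q hq).eventually_nhds, self_mem_nhdsWithin,
        nhdsWithin_le_nhds ((hu q hq).eventually_mem (Metric.ball_mem_nhds _ hε))]
        with q' hq' hq'V hq'ε
      refine ⟨Metric.ball (u q) ε, h q, Metric.isOpen_ball, (convex_ball _ _).isPreconnected,
        hball, Metric.mem_ball_self hε, hq'ε, EventuallyEq.rfl, huo q' hq'V ?_⟩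
      exact (hq'.and (hG q' hq'V)).mono fun z hz => hz.1.symm.trans hz.2
    · rintro a b c - - - ⟨J, H, hJ, hJc, hH, ha, hb, hHa, hHb⟩
        ⟨J', H', hJ', hJc', hH', hb', hc', hHb', hHc'⟩
      classical
      have hpre : IsPreconnected (J ∩ J') :=
        (hJc.ordConnected.inter hJc'.ordConnected).isPreconnected
      have heq : EqOn H H' (J ∩ J') :=
        (hH.mono inter_subset_left).eqOn_of_preconnected_of_eventuallyEq
          (hH'.mono inter_subset_right) hpre ⟨hb, hb'⟩ (hHb.trans hHb'.symm)
      have e1 : EqOn (J.piecewise H H') H J := piecewise_eqOn _ _ _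
      have e2 : EqOn (J.piecewise H H') H' J' := fun t ht => by
        by_cases htJ : t ∈ J
        · rw [e1 htJ, heq ⟨htJ, ht⟩]
        · exact piecewise_eqOn_compl _ _ _ htJ
      have e1' : ∀ t ∈ J, J.piecewise H H' =ᶠ[𝓝 t] H := fun t ht =>
        e1.eventuallyEq_of_mem (hJ.mem_nhds ht)
      have e2' : ∀ t ∈ J', J.piecewise H H' =ᶠ[𝓝 t] H' := fun t ht =>
        e2.eventuallyEq_of_mem (hJ'.mem_nhds ht)
      refine ⟨J ∪ J', J.piecewise H H', hJ.union hJ', hJc.union' ⟨_, hb, hb'⟩ hJc', ?_,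
        Or.inl ha, Or.inr hc', (e1' _ ha).trans hHa, (e2' _ hc').trans hHc'⟩
      rintro t (ht | ht)
      · exact (hH t ht).congr (e1' t ht).symm
      · exact (hH' t ht).congr (e2' t ht).symm
    · rintro a b - - ⟨J, H, hJ, hJc, hH, ha, hb, hHa, hHb⟩
      exact ⟨J, H, hJ, hJc, hH, hb, ha, hHb, hHa⟩
  have hwd : ∀ q₁ ∈ V, ∀ q₂ ∈ V, u q₁ = u q₂ → G q₁ = G q₂ := by
    intro q₁ hq₁ q₂ hq₂ he
    obtain ⟨J, H, -, -, -, -, -, e1, e2⟩ := key q₁ hq₁ q₂ hq₂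
    rw [(hG q₁ hq₁).self_of_nhds, (hG q₂ hq₂).self_of_nhds, ← e1.self_of_nhds,
      ← e2.self_of_nhds, he]
  have hex : ∀ t ∈ u '' V, ∃ r, ∀ q ∈ V, u q = t → G q = r := by
    rintro _ ⟨q, hq, rfl⟩
    exact ⟨G q, fun q' hq' he => hwd q' hq' q hq he⟩
  choose! H hH using hex
  have hfac : ∀ q ∈ V, G q = H (u q) := fun q hq => hH _ (mem_image_of_mem u hq) q hq rfl
  refine ⟨H, ?_, hfac⟩
  rintro _ ⟨q, hq, rfl⟩
  refine (hh q hq).congr (huo q hq ?_)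
  exact ((hG q hq).and (hV.mem_nhds hq)).mono fun z hz => hz.1.symm.trans (hfac z hz.2)

lemma pdx_eq_fderiv {f : ℝ × ℝ → ℝ} {p : ℝ × ℝ} (hf : DifferentiableAt ℝ f p) :
    pdx f p = fderiv ℝ f p (1, 0) :=
  (hf.hasFDerivAt.comp_hasDerivAt_of_eq p.1
    ((hasDerivAt_id p.1).prodMk (hasDerivAt_const p.1 p.2)) rfl).deriv

lemma pdy_eq_fderiv {f : ℝ × ℝ → ℝ} {p : ℝ × ℝ} (hf : DifferentiableAt ℝ f p) :
    pdy f p = fderiv ℝ f p (0, 1) :=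
  (hf.hasFDerivAt.comp_hasDerivAt_of_eq p.2
    ((hasDerivAt_const p.2 p.1).prodMk (hasDerivAt_id p.2)) rfl).deriv

lemma AnalyticAt.pdx {f : ℝ × ℝ → ℝ} {p : ℝ × ℝ} (hf : AnalyticAt ℝ f p) :
    AnalyticAt ℝ (pdx f) p := by
  have h : AnalyticAt ℝ (fun q => fderiv ℝ f q (1, 0)) p :=
    ((ContinuousLinearMap.apply ℝ ℝ ((1, 0) : ℝ × ℝ)).analyticAt _).comp hf.fderiv
  exact h.congr <| hf.eventually_analyticAt.mono fun _ hq => (pdx_eq_fderiv hq.differentiableAt).symm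

lemma AnalyticAt.pdy {f : ℝ × ℝ → ℝ} {p : ℝ × ℝ} (hf : AnalyticAt ℝ f p) :
    AnalyticAt ℝ (pdy f) p := by
  have h : AnalyticAt ℝ (fun q => fderiv ℝ f q (0, 1)) p :=
    ((ContinuousLinearMap.apply ℝ ℝ ((0, 1) : ℝ × ℝ)).analyticAt _).comp hf.fderiv
  exact h.congr <| hf.eventually_analyticAt.mono fun _ hq => (pdy_eq_fderiv hq.differentiableAt).symm

lemma Filter.EventuallyEq.pdx_eq {f g : ℝ × ℝ → ℝ} {p : ℝ × ℝ} (h : f =ᶠ[𝓝 p] g) :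
    pdx f p = pdx g p :=
  EventuallyEq.deriv_eq <|
    ((Continuous.prodMk_left p.2).tendsto p.1).eventually h

lemma Filter.EventuallyEq.pdy_eq {f g : ℝ × ℝ → ℝ} {p : ℝ × ℝ} (h : f =ᶠ[𝓝 p] g) :
    pdy f p = pdy g p :=
  EventuallyEq.deriv_eq <|
    ((Continuous.prodMk_right p.1).tendsto p.2).eventually h

lemma eventually_eq_of_pdy_eq_zero {F : ℝ × ℝ → ℝ} {p : ℝ × ℝ} (hF : AnalyticAt ℝ F p)
    (h : ∀ᶠ q in 𝓝 p, pdy F q = 0) : ∀ᶠ q in 𝓝 p, F q = F (q.1, p.2) := by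
  obtain ⟨ε, hε, hball⟩ := Metric.eventually_nhds_iff_ball.1 (h.and hF.eventually_analyticAt)
  filter_upwards [Metric.ball_mem_nhds p hε] with q hq
  rw [← ball_prod_same] at hq hball
  have hd : ∀ t ∈ Metric.ball p.2 ε, DifferentiableAt ℝ (fun t => F (q.1, t)) t := fun t ht =>
    (hball (q.1, t) ⟨hq.1, ht⟩).2.differentiableAt.fun_comp' t
      ((differentiableAt_const q.1).prodMk differentiableAt_id)
  exact Metric.isOpen_ball.is_const_of_deriv_eq_zero (convex_ball p.2 ε).isPreconnected
    (fun t ht => (hd t ht).differentiableWithinAt)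
    (fun t ht => (hball (q.1, t) ⟨hq.1, ht⟩).1) hq.2 (Metric.mem_ball_self hε)

lemma eventually_eq_of_pdx_eq_zero {F : ℝ × ℝ → ℝ} {p : ℝ × ℝ} (hF : AnalyticAt ℝ F p)
    (h : ∀ᶠ q in 𝓝 p, pdx F q = 0) : ∀ᶠ q in 𝓝 p, F q = F (p.1, q.2) := by
  have hs : Tendsto Prod.swap (𝓝 p) (𝓝 p.swap) := continuous_swap.continuousAt
  have hs' : Tendsto Prod.swap (𝓝 p.swap) (𝓝 p) := continuous_swap.tendsto' _ _ p.swap_swap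
  refine hs.eventually (eventually_eq_of_pdy_eq_zero (F := F ∘ Prod.swap) (p := p.swap) ?_
    (hs'.eventually h))
  exact AnalyticAt.comp_of_eq hF (analyticAt_snd.prod analyticAt_fst) rfl

lemma AnalyticOnNhd.exists_primitive {J : Set ℝ} {f : ℝ → ℝ} (hf : AnalyticOnNhd ℝ f J)
    (hJ : IsOpen J) (hJc : IsPreconnected J) :
    ∃ F, AnalyticOnNhd ℝ F J ∧ ∀ x ∈ J, HasDerivAt F (f x) x := by
  obtain rfl | ⟨x₀, hx₀⟩ := J.eq_empty_or_nonempty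
  · exact ⟨f, hf, fun x hx => hx.elim⟩
  have hd : ∀ x ∈ J, HasDerivAt (fun x => ∫ t in x₀..x, f t) (f x) x := fun x hx =>
    intervalIntegral.integral_hasDerivAt_right
      (hf.continuousOn.mono (hJc.ordConnected.uIcc_subset hx₀ hx)).intervalIntegrable
      (hf.continuousOn.stronglyMeasurableAtFilter hJ x hx) (hf x hx).continuousAt
  exact ⟨_, fun x hx => (hf x hx).of_eventually_hasDerivAt <|
    (hJ.eventually_mem hx).mono hd, hd⟩

lemma HasDerivAt.comp_pdx_pdy {f : ℝ × ℝ → ℝ} {g₁ g₂ : ℝ → ℝ} {g₁' g₂' t : ℝ}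
    (hf : DifferentiableAt ℝ f (g₁ t, g₂ t)) (h₁ : HasDerivAt g₁ g₁' t)
    (h₂ : HasDerivAt g₂ g₂' t) :
    HasDerivAt (fun t => f (g₁ t, g₂ t))
      (pdx f (g₁ t, g₂ t) * g₁' + pdy f (g₁ t, g₂ t) * g₂') t := by
  have h := hf.hasFDerivAt.comp_hasDerivAt t (h₁.prodMk h₂)
  have e : (g₁', g₂') = g₁' • ((1, 0) : ℝ × ℝ) + g₂' • ((0, 1) : ℝ × ℝ) := by simp
  rw [e, map_add, map_smul, map_smul, ← pdx_eq_fderiv hf, ← pdy_eq_fderiv hf] at h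
  simp only [smul_eq_mul, mul_comm g₁', mul_comm g₂'] at h
  exact h

/-- A function whose gradient is parallel to that of `a x + b y` locally factors through it. -/
lemma exists_local_factorization {P : ℝ × ℝ → ℝ} {q : ℝ × ℝ} {a b : ℝ → ℝ}
    (hP : AnalyticAt ℝ P q) (ha : AnalyticAt ℝ a q.1) (hb : AnalyticAt ℝ b q.2)
    (ha' : deriv a q.1 ≠ 0)
    (h : ∀ᶠ z in 𝓝 q, pdy P z * deriv a z.1 = pdx P z * deriv b z.2) :
    ∃ g, AnalyticAt ℝ g (a q.1 + b q.2) ∧ ∀ᶠ z in 𝓝 q, P z = g (a z.1 + b z.2) := by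
  set c := ha.hasStrictDerivAt.localInverse _ _ _ ha'
  have hc : AnalyticAt ℝ c (a q.1) := ha.analyticAt_localInverse ha'
  have hca : c (a q.1) = q.1 := HasStrictFDerivAt.localInverse_apply_image ..
  have hleft : ∀ᶠ x in 𝓝 q.1, c (a x) = x := HasStrictDerivAt.eventually_left_inverse ..
  have hright : ∀ᶠ s in 𝓝 (a q.1), a (c s) = s := HasStrictDerivAt.eventually_right_inverse ..
  set p : ℝ × ℝ := (a q.1 + b q.2, q.2) with hp
  let ψ : ℝ × ℝ → ℝ := fun w => w.1 - b w.2
  let φ : ℝ × ℝ → ℝ × ℝ := fun w => (c (ψ w), w.2)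
  have hψp : ψ p = a q.1 := by simp [ψ, hp]
  have hφp : φ p = q := Prod.ext ((congrArg c hψp).trans hca) rfl
  have hψ : AnalyticAt ℝ ψ p :=
    analyticAt_fst.sub (AnalyticAt.comp (f := Prod.snd) (x := p) hb analyticAt_snd)
  have hφ : AnalyticAt ℝ φ p := (hc.comp_of_eq hψ hψp).prod analyticAt_snd
  have hφt : Tendsto φ (𝓝 p) (𝓝 q) := hφp ▸ hφ.continuousAt
  have hψt : Tendsto ψ (𝓝 p) (𝓝 (a q.1)) := hψp ▸ hψ.continuousAt
  have hQ : AnalyticAt ℝ (P ∘ φ) p := hP.comp_of_eq hφ hφp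
  have hfst : Tendsto Prod.fst (𝓝 q) (𝓝 q.1) := continuous_fst.continuousAt
  have hsnd : Tendsto Prod.snd (𝓝 p) (𝓝 q.2) := continuous_snd.continuousAt
  have hQ0 : ∀ᶠ w in 𝓝 p, pdy (P ∘ φ) w = 0 := by
    filter_upwards [hφt.eventually h, hφt.eventually hP.eventually_analyticAt,
      hφt.eventually (hfst.eventually ha.eventually_analyticAt),
      hψt.eventually hright.eventually_nhds, hψt.eventually hc.eventually_analyticAt,
      hsnd.eventually hb.eventually_analyticAt]
      with w h1 h2 h3 h4 h5 h6
    have hcd := h5.differentiableAt.hasDerivAt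
    have hone : deriv a (c (ψ w)) * deriv c (ψ w) = 1 :=
      ((h3.differentiableAt.hasDerivAt.comp (ψ w) hcd).congr_of_eventuallyEq
        (h4.mono fun s hs => hs.symm)).unique (hasDerivAt_id _)
    have hinner : HasDerivAt (fun t => c (w.1 - b t)) (deriv c (ψ w) * -deriv b w.2) w.2 :=
      hcd.comp w.2 (h6.differentiableAt.hasDerivAt.const_sub w.1)
    have hd := HasDerivAt.comp_pdx_pdy (f := P) (t := w.2) h2.differentiableAt hinner
      (hasDerivAt_id w.2)
    refine hd.deriv.trans ?_
    change pdx P (φ w) * _ + pdy P (φ w) * 1 = 0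
    change pdy P (φ w) * deriv a (c (ψ w)) = pdx P (φ w) * deriv b w.2 at h1
    linear_combination deriv c (ψ w) * h1 - pdy P (φ w) * hone
  have hF := eventually_eq_of_pdy_eq_zero hQ hQ0
  refine ⟨fun v => (P ∘ φ) (v, q.2), AnalyticAt.comp_of_eq (g := P ∘ φ) hQ
    (analyticAt_id.prod analyticAt_const) rfl, ?_⟩
  have hu : Tendsto (fun z : ℝ × ℝ => (a z.1 + b z.2, z.2)) (𝓝 q) (𝓝 p) := by
    have h1 : ContinuousAt (fun z : ℝ × ℝ => a z.1) q := ha.continuousAt.comp continuousAt_fst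
    have h2 : ContinuousAt (fun z : ℝ × ℝ => b z.2) q := hb.continuousAt.comp continuousAt_snd
    exact (h1.add h2).prodMk continuousAt_snd
  filter_upwards [hu.eventually hF, hfst.eventually hleft] with z hz hz'
  rw [← hz]
  simp [φ, ψ, hz']

/-- An analytic function with vanishing mixed derivative on a connected open set splits globally
as a sum of univariate analytic functions. -/
lemma exists_eq_add_of_pdx_pdy_eq_zero {V : Set (ℝ × ℝ)} (hV : IsOpen V)
    (hVc : IsPreconnected V) {f : ℝ × ℝ → ℝ} (hf : AnalyticOnNhd ℝ f V)
    (h : ∀ q ∈ V, pdx (pdy f) q = 0) :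
    ∃ α β : ℝ → ℝ, AnalyticOnNhd ℝ α (Prod.fst '' V) ∧ AnalyticOnNhd ℝ β (Prod.snd '' V) ∧
      ∀ q ∈ V, f q = α q.1 + β q.2 := by
  obtain ⟨B, hB, hfB⟩ := hVc.exists_analytic_factorization hV (u := Prod.snd) (G := pdy f)
    (fun q _ => continuousAt_snd) (fun q _ => map_snd_nhds q |>.ge) fun q hq =>
      ⟨fun t => pdy f (q.1, t),
        AnalyticAt.comp_of_eq (hf q hq).pdy (analyticAt_const.prod analyticAt_id) rfl,
        eventually_eq_of_pdx_eq_zero (hf q hq).pdy ((hV.eventually_mem hq).mono h)⟩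
  obtain ⟨β, hβ, hβB⟩ := hB.exists_primitive (isOpenMap_snd V hV)
    (hVc.image _ continuous_snd.continuousOn)
  have hβ' : ∀ q ∈ V, AnalyticAt ℝ (fun z : ℝ × ℝ => β z.2) q := fun q hq =>
    AnalyticAt.comp (f := Prod.snd) (hβ _ (mem_image_of_mem _ hq)) analyticAt_snd
  have hdiff : ∀ q ∈ V, pdy (fun z => f z - β z.2) q = 0 := by
    intro q hq
    have h1 := HasDerivAt.comp_pdx_pdy (f := f) (t := q.2) (hf q hq).differentiableAt
      (hasDerivAt_const q.2 q.1) (hasDerivAt_id q.2)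
    refine (h1.sub (hβB _ (mem_image_of_mem _ hq))).deriv.trans ?_
    simp [← hfB q hq]
  obtain ⟨α, hα, hfα⟩ := hVc.exists_analytic_factorization hV (u := Prod.fst)
    (G := fun z => f z - β z.2)
    (fun q _ => continuousAt_fst) (fun q _ => map_fst_nhds q |>.ge) fun q hq =>
      ⟨fun t => f (t, q.2) - β q.2,
        AnalyticAt.comp_of_eq (g := fun z : ℝ × ℝ => f z - β z.2) ((hf q hq).sub (hβ' q hq))
          (analyticAt_id.prod analyticAt_const) rfl,
        eventually_eq_of_pdy_eq_zero ((hf q hq).sub (hβ' q hq))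
          ((hV.eventually_mem hq).mono hdiff)⟩
  exact ⟨α, β, hα, hβ, fun q hq => by rw [← hfα q hq, sub_add_cancel]⟩

lemma pdx_pdy_log_eq_zero {P : ℝ × ℝ → ℝ} {p : ℝ × ℝ} {h a b : ℝ → ℝ}
    (ha : AnalyticAt ℝ a p.1) (hb : AnalyticAt ℝ b p.2) (hh : AnalyticAt ℝ h (a p.1 + b p.2))
    (hP : AnalyticAt ℝ P p) (hPx : pdx P p ≠ 0) (hPy : pdy P p ≠ 0)
    (he : ∀ᶠ q in 𝓝 p, P q = h (a q.1 + b q.2)) :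
    pdx (pdy fun q => Real.log (pdx P q / pdy P q)) p = 0 := by
  have hfst : Tendsto Prod.fst (𝓝 p) (𝓝 p.1) := continuous_fst.continuousAt
  have hsnd : Tendsto Prod.snd (𝓝 p) (𝓝 p.2) := continuous_snd.continuousAt
  have hu : Tendsto (fun z : ℝ × ℝ => a z.1 + b z.2) (𝓝 p) (𝓝 (a p.1 + b p.2)) :=
    (ha.continuousAt.tendsto.comp hfst).add (hb.continuousAt.tendsto.comp hsnd)
  have key : (fun q => Real.log (pdx P q / pdy P q)) =ᶠ[𝓝 p]
      fun q => Real.log (deriv a q.1) - Real.log (deriv b q.2) := by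
    filter_upwards [he.eventually_nhds, hfst.eventually ha.eventually_analyticAt,
      hsnd.eventually hb.eventually_analyticAt, hu.eventually hh.eventually_analyticAt,
      hP.pdx.continuousAt.eventually_ne hPx, hP.pdy.continuousAt.eventually_ne hPy]
      with q h1 h2 h3 h4 h5 h6
    have hx : pdx P q = deriv h (a q.1 + b q.2) * deriv a q.1 :=
      (EventuallyEq.pdx_eq h1).trans
        (h4.differentiableAt.hasDerivAt.comp q.1
          (h2.differentiableAt.hasDerivAt.add_const (b q.2))).deriv
    have hy : pdy P q = deriv h (a q.1 + b q.2) * deriv b q.2 :=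
      (EventuallyEq.pdy_eq h1).trans
        (h4.differentiableAt.hasDerivAt.comp q.2
          (h3.differentiableAt.hasDerivAt.const_add (a q.1))).deriv
    rw [hx] at h5
    rw [hy] at h6
    rw [hx, hy, mul_div_mul_left _ _ (left_ne_zero_of_mul h5),
      Real.log_div (right_ne_zero_of_mul h5) (right_ne_zero_of_mul h6)]
  have key' := key.eventuallyEq_nhds.mono fun _ hq => EventuallyEq.pdy_eq hq
  rw [EventuallyEq.pdx_eq key']
  simp [pdx, pdy]

lemma exists_sign {X : Type*} [TopologicalSpace X] {V : Set X} (hVc : IsPreconnected V)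
    {r : X → ℝ} (hr : ContinuousOn r V) (h0 : ∀ q ∈ V, r q ≠ 0) :
    ∃ s : ℝ, s * s = 1 ∧ ∀ q ∈ V, r q = s * |r q| := by
  by_cases hpos : ∃ q ∈ V, 0 < r q
  · obtain ⟨q, hq, hq0⟩ := hpos
    refine ⟨1, one_mul 1, fun z hz => ?_⟩
    rw [one_mul, abs_of_nonneg]
    by_contra! hneg
    obtain ⟨w, hw, hw0⟩ := hVc.intermediate_value hz hq hr ⟨hneg.le, hq0.le⟩
    exact h0 w hw hw0
  · push Not at hpos
    exact ⟨-1, by norm_num, fun z hz => by rw [abs_of_nonpos (hpos z hz), neg_one_mul, neg_neg]⟩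

/-- A vanishing mixed derivative of `log (∂ₓP / ∂ᵧP)` on a connected open set yields a global
representation of `P` as `h (a x + b y)`. -/
lemma exists_special_form_of_pdx_pdy_log_eq_zero {V : Set (ℝ × ℝ)} (hV : IsOpen V)
    (hVc : IsPreconnected V) {P : ℝ × ℝ → ℝ} (hP : AnalyticOnNhd ℝ P V)
    (hPx : ∀ q ∈ V, pdx P q ≠ 0) (hPy : ∀ q ∈ V, pdy P q ≠ 0)
    (h : ∀ q ∈ V, pdx (pdy fun q => Real.log (pdx P q / pdy P q)) q = 0) :
    ∃ h a b : ℝ → ℝ, AnalyticOnNhd ℝ a (Prod.fst '' V) ∧ AnalyticOnNhd ℝ b (Prod.snd '' V) ∧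
      AnalyticOnNhd ℝ h ((fun q : ℝ × ℝ => a q.1 + b q.2) '' V) ∧
      ∀ q ∈ V, P q = h (a q.1 + b q.2) := by
  set r : ℝ × ℝ → ℝ := fun q => pdx P q / pdy P q
  have hr : AnalyticOnNhd ℝ r V := fun q hq => (hP q hq).pdx.div (hP q hq).pdy (hPy q hq)
  have hr0 : ∀ q ∈ V, r q ≠ 0 := fun q hq => div_ne_zero (hPx q hq) (hPy q hq)
  have hlog : AnalyticOnNhd ℝ (fun q => Real.log (r q)) V := fun q hq => by
    have h1 : AnalyticAt ℝ (fun q => 2⁻¹ * Real.log (r q ^ 2)) q :=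
      analyticAt_const.mul <|
        (analyticAt_log (sq_pos_of_ne_zero (hr0 q hq))).comp_of_eq ((hr q hq).fun_pow 2) rfl
    exact h1.congr (Eventually.of_forall fun z => by simp [Real.log_pow])
  obtain ⟨α, β, hα, hβ, hαβ⟩ := exists_eq_add_of_pdx_pdy_eq_zero hV hVc hlog h
  obtain ⟨s, hs, hrs⟩ := exists_sign hVc hr.continuousOn hr0
  obtain ⟨a, ha, ha'⟩ := AnalyticOnNhd.exists_primitive (f := fun x => Real.exp (α x))
    (fun x hx => (hα x hx).rexp') (isOpenMap_fst V hV) (hVc.image _ continuous_fst.continuousOn)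
  obtain ⟨b, hb, hb'⟩ := AnalyticOnNhd.exists_primitive (f := fun y => s * Real.exp (-β y))
    (fun y hy => analyticAt_const.mul (hβ y hy).neg.rexp') (isOpenMap_snd V hV)
    (hVc.image _ continuous_snd.continuousOn)
  have hfst : ∀ q ∈ V, q.1 ∈ Prod.fst '' V := fun q hq => mem_image_of_mem _ hq
  have hsnd : ∀ q ∈ V, q.2 ∈ Prod.snd '' V := fun q hq => mem_image_of_mem _ hq
  have hgrad : ∀ q ∈ V, pdy P q * deriv a q.1 = pdx P q * deriv b q.2 := by
    intro q hq
    have h1 : pdx P q = r q * pdy P q := (div_mul_cancel₀ _ (hPy q hq)).symm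
    rw [(ha' _ (hfst q hq)).deriv, (hb' _ (hsnd q hq)).deriv, h1, hrs q hq,
      ← Real.exp_log_eq_abs (hr0 q hq), hαβ q hq, Real.exp_add, Real.exp_neg]
    have := (Real.exp_pos (β q.2)).ne'
    field_simp
    linear_combination -pdy P q * hs
  have ha0 : ∀ q ∈ V, deriv a q.1 ≠ 0 := fun q hq => by
    rw [(ha' _ (hfst q hq)).deriv]
    exact (Real.exp_pos _).ne'
  obtain ⟨g, hg, hPg⟩ := hVc.exists_analytic_factorization hV
    (u := fun q : ℝ × ℝ => a q.1 + b q.2) (G := P)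
    (fun q hq => ((ha _ (hfst q hq)).continuousAt.comp continuousAt_fst).add
      ((hb _ (hsnd q hq)).continuousAt.comp continuousAt_snd))
    (fun q hq => by
      have hd : HasStrictDerivAt (fun x => a x + b q.2) (deriv a q.1) q.1 :=
        (ha _ (hfst q hq)).hasStrictDerivAt.add_const _
      refine (hd.map_nhds_eq (ha0 q hq)).ge.trans ?_
      exact (Filter.map_mono ((Continuous.prodMk_left q.2).tendsto q.1)).trans_eq' (map_map ..))
    (fun q hq => exists_local_factorization (hP q hq) (ha _ (hfst q hq)) (hb _ (hsnd q hq))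
      (ha0 q hq) ((hV.eventually_mem hq).mono hgrad))
  exact ⟨g, a, b, ha, hb, hg, hPg⟩

/-- Elekes–Rónyai: Let `P` be analytic on a connected open `U ⊆ ℝ²`.
If neither `∂ₓP` nor `∂ᵧP` vanishes identically on `U`, then `P` is an analytic special
form iff `∂ₓᵧ(log(∂ₓP/∂ᵧP))` vanishes everywhere on `U` where it is defined (i.e. where
`∂ₓP, ∂ᵧP ≠ 0`).  Moreover, if `∂ₓP` or `∂ᵧP` vanishes identically on `U`, then `P`
is an analytic special form.  (`Real.log` satisfies `log (−x) = log x`.) -/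
theorem specialForm_iff_log_mixed_deriv_zero (U : Set (ℝ × ℝ)) (hUo : IsOpen U)
    (hUc : IsConnected U) (P : ℝ × ℝ → ℝ) (hP : AnalyticOnNhd ℝ P U) :
    (((¬ ∀ p ∈ U, pdx P p = 0) ∧ (¬ ∀ p ∈ U, pdy P p = 0)) →
      (IsAnalyticSpecialForm U P ↔
        ∀ p ∈ U, pdx P p ≠ 0 → pdy P p ≠ 0 →
          pdx (pdy (fun q => Real.log (pdx P q / pdy P q))) p = 0))
    ∧
    (((∀ p ∈ U, pdx P p = 0) ∨ (∀ p ∈ U, pdy P p = 0)) → IsAnalyticSpecialForm U P) := by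
  have hW : IsOpen {q ∈ U | pdx P q ≠ 0 ∧ pdy P q ≠ 0} := isOpen_iff_eventually.2 fun q hq =>
    (hUo.eventually_mem hq.1).and <|
      ((hP q hq.1).pdx.continuousAt.eventually_ne hq.2.1).and
        ((hP q hq.1).pdy.continuousAt.eventually_ne hq.2.2)
  refine ⟨fun _ => ⟨fun hsf p hp hpx hpy => ?_, fun h p hp => ?_⟩, ?_⟩
  · obtain ⟨h, a, b, ha, hb, hh, he⟩ := hsf p ⟨hp, hpx, hpy⟩
    have hmem := mem_connectedComponentIn (F := {q ∈ U | pdx P q ≠ 0 ∧ pdy P q ≠ 0})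
      ⟨hp, hpx, hpy⟩
    exact pdx_pdy_log_eq_zero (ha _ (mem_image_of_mem _ hmem)) (hb _ (mem_image_of_mem _ hmem))
      (hh _ (mem_image_of_mem _ hmem)) (hP p hp) hpx hpy
      ((hW.connectedComponentIn.eventually_mem hmem).mono he)
  · have hsub := connectedComponentIn_subset {q ∈ U | pdx P q ≠ 0 ∧ pdy P q ≠ 0} p
    exact exists_special_form_of_pdx_pdy_log_eq_zero hW.connectedComponentIn
      isPreconnected_connectedComponentIn (fun q hq => hP q (hsub hq).1)
      (fun q hq => (hsub hq).2.1) (fun q hq => (hsub hq).2.2)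
      (fun q hq => h q (hsub hq).1 (hsub hq).2.1 (hsub hq).2.2)
  · rintro (h | h) p hp
    · exact absurd (h p hp.1) hp.2.1
    · exact absurd (h p hp.1) hp.2.2
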